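/- Let k be a local field of characteristic p and a ∈ k with v_k(a) = −i where i > 0 is prime to p. Then the Artin–Schreier extension l = k(b), b^p − b = a, is a totally ramified cyclic extension of degree p whose ramification filtration in lower numbering satisfies Gal(l/k)_j = Gal(l/k) for j ≤ i and Gal(l/k)_j = 1 for j > i. -/

import Mathlib

namespace AddValuation

section Ring

variable {R Γ₀ : Type*} [Ring R] [LinearOrderedAddCommMonoidWithTop Γ₀] (v : AddValuation R Γ₀)

/-- If the terms of finite valuation in a nonempty finite sum have pairwise distinct valuations,
the sum has the valuation of a term of least valuation. -/
theorem exists_map_sum_eq {ι : Type*} {s : Finset ι} (hs : s.Nonempty) (t : ι → R)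
    (ht : ∀ m ∈ s, ∀ n ∈ s, v (t m) = v (t n) → v (t m) ≠ ⊤ → m = n) :
    ∃ m ∈ s, v (∑ n ∈ s, t n) = v (t m) ∧ ∀ n ∈ s, v (t m) ≤ v (t n) := by
  classical
  induction hs using Finset.Nonempty.cons_induction with
  | singleton a => exact ⟨a, by simp⟩
  | cons a s ha hs ih =>
    obtain ⟨m, hm, hsum, hmin⟩ := ih fun m hm n hn ↦
      ht m (Finset.mem_cons_of_mem hm) n (Finset.mem_cons_of_mem hn)
    rw [Finset.sum_cons]
    rcases lt_trichotomy (v (t a)) (v (t m)) with h | h | h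
    · refine ⟨a, Finset.mem_cons_self a s, map_add_eq_of_lt_left v (hsum ▸ h), ?_⟩
      simpa using fun n hn ↦ h.le.trans (hmin n hn)
    · have htop : v (t a) = ⊤ := by
        by_contra hne
        exact ha (ht a (Finset.mem_cons_self a s) m (Finset.mem_cons_of_mem hm) h hne ▸ hm)
      refine ⟨m, Finset.mem_cons_of_mem hm, ?_, by simpa using ⟨h.ge, hmin⟩⟩
      rw [← h, htop, ← top_le_iff]
      exact v.map_le_add htop.ge (hsum.trans (h.symm.trans htop)).ge
    · exact ⟨m, Finset.mem_cons_of_mem hm, (map_add_eq_of_lt_right v (hsum ▸ h)).trans hsum,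
        by simpa using ⟨h.le, hmin⟩⟩

/-- The elements which a valuation-preserving endomorphism `g` moves by at least `j` relative to
their own valuation. -/
def displacementSubmonoid (g : R →+* R) (hg : ∀ x, v (g x) = v x) (j : Γ₀) : Submonoid R where
  carrier := {y | v y + j ≤ v (g y - y)}
  one_mem' := by simp
  mul_mem' {y z} hy hz := by
    have h : g (y * z) - y * z = g y * (g z - z) + (g y - y) * z := by
      rw [_root_.map_mul]; noncomm_ring
    simp only [Set.mem_ofPred_eq] at hy hz ⊢
    rw [h]
    apply v.map_le_add <;> rw [v.map_mul, v.map_mul]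
    · rw [hg, add_assoc]
      gcongr
    · rw [add_right_comm]
      gcongr

theorem mem_displacementSubmonoid {g : R →+* R} {hg : ∀ x, v (g x) = v x} {j : Γ₀} {y : R} :
    y ∈ v.displacementSubmonoid g hg j ↔ v y + j ≤ v (g y - y) :=
  Iff.rfl

end Ring

variable {K Γ₀ : Type*} [Field K] [LinearOrderedAddCommMonoidWithTop Γ₀] (v : AddValuation K Γ₀)

theorem inv_mem_displacementSubmonoid {g : K →+* K} {hg : ∀ x, v (g x) = v x} {j : Γ₀} {y : K}
    (hy : y ∈ v.displacementSubmonoid g hg j) : y⁻¹ ∈ v.displacementSubmonoid g hg j := by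
  rcases eq_or_ne y 0 with rfl | hy0
  · simpa using hy
  have hgy : g y ≠ 0 := (map_ne_zero g).2 hy0
  have h : g y⁻¹ - y⁻¹ = -((g y - y) * (y⁻¹ * g y⁻¹)) := by
    rw [map_inv₀]; field_simp; ring
  have h0 : v y + v y⁻¹ = 0 := by rw [← v.map_mul, mul_inv_cancel₀ hy0, v.map_one]
  rw [mem_displacementSubmonoid] at hy ⊢
  rw [h, v.map_neg, v.map_mul, v.map_mul, hg]
  calc v y⁻¹ + j = (v y + v y⁻¹) + (v y⁻¹ + j) := by rw [h0, zero_add]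
    _ = (v y + j) + (v y⁻¹ + v y⁻¹) := by ac_rfl
    _ ≤ _ := by gcongr

theorem map_eq_zero_of_pow_eq_self {v : AddValuation K (WithTop ℤ)} {c : K} (hc : c ≠ 0) {p : ℕ}
    (hp : p ≠ 1) (h : c ^ p = c) : v c = 0 := by
  obtain ⟨n, hn⟩ := WithTop.ne_top_iff_exists.1 (v.ne_top_iff.2 hc)
  have h1 := congrArg v h
  rw [v.map_pow, ← hn, ← WithTop.coe_nsmul, WithTop.coe_inj, nsmul_eq_mul] at h1
  have h2 : ((p : ℤ) - 1) * n = 0 := by linear_combination h1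
  have h3 : (p : ℤ) - 1 ≠ 0 := by omega
  rw [← hn, (mul_eq_zero.1 h2).resolve_left h3, WithTop.coe_zero]

/-- For `c < 0`, a solution of `b ^ p - b = a` with `v a = c` satisfies `p * v b = c`. -/
theorem exists_map_eq_of_pow_sub_self {v : AddValuation K (WithTop ℤ)} {b : K} {p : ℕ}
    (hp : 1 < p) {c : ℤ} (hc : c < 0) (h : v (b ^ p - b) = c) :
    ∃ n : ℤ, v b = n ∧ p * n = c := by
  have hneg : v b < 0 := by
    by_contra! hb
    have h1 : 0 ≤ v (b ^ p - b) := v.map_le_sub (by rw [v.map_pow]; exact nsmul_nonneg hb p) hb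
    rw [h, ← WithTop.coe_zero, WithTop.coe_le_coe] at h1
    omega
  obtain ⟨n, hn⟩ := WithTop.ne_top_iff_exists.1 (hneg.trans_le le_top).ne
  rw [← hn, ← WithTop.coe_zero, WithTop.coe_lt_coe] at hneg
  have hpow : v (b ^ p) = ((p * n : ℤ) : WithTop ℤ) := by
    rw [v.map_pow, ← hn, ← WithTop.coe_nsmul, nsmul_eq_mul]
  refine ⟨n, hn.symm, ?_⟩
  rw [v.map_sub_eq_of_lt_left, hpow, WithTop.coe_inj] at h
  · exact h
  · rw [hpow, ← hn, WithTop.coe_lt_coe]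
    nlinarith

end AddValuation

namespace ArtinSchreier

open Polynomial

variable {k l : Type*} [Field k] [Field l] [Algebra k l] {p : ℕ} {a : k} {b : l}

theorem monic (hp : 1 < p) : (X ^ p - X - C a : k[X]).Monic := by
  rw [sub_sub]
  exact monic_X_pow_sub (by rw [degree_X_add_C]; exact_mod_cast hp)

theorem natDegree_eq (hp : 1 < p) : (X ^ p - X - C a : k[X]).natDegree = p := by
  rw [natDegree_sub_C, FiniteField.X_pow_card_sub_X_natDegree_eq k hp]

theorem exists_eq_sum (hp : 1 < p) (hb : b ^ p - b = algebraMap k l a)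
    (hgen : Algebra.adjoin k {b} = ⊤) (x : l) :
    ∃ c : Fin p → k, x = ∑ m, algebraMap k l (c m) * b ^ (m : ℕ) := by
  have hx : x ∈ Algebra.adjoin k {b} := hgen ▸ Algebra.mem_top
  rw [Algebra.adjoin_singleton_eq_range_aeval] at hx
  obtain ⟨q, rfl⟩ := hx
  have hf := monic (a := a) hp
  have hdeg : (q %ₘ (X ^ p - X - C a)).natDegree < p := by
    have := natDegree_modByMonic_lt q hf fun h ↦ by
      have := natDegree_eq (a := a) hp
      rw [h, natDegree_one] at this
      omega
    rwa [natDegree_eq hp] at this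
  refine ⟨fun m ↦ (q %ₘ (X ^ p - X - C a)).coeff m, ?_⟩
  rw [Fin.sum_univ_eq_sum_range
      (fun m ↦ algebraMap k l ((q %ₘ (X ^ p - X - C a)).coeff m) * b ^ m) p]
  change aeval b q = _
  rw [← aeval_modByMonic_eq_self_of_root (p := q) (q := X ^ p - X - C a) (x := b) (by simp [hb]),
    aeval_eq_sum_range' hdeg]
  simp [Algebra.smul_def]

theorem splits [Fact p.Prime] [CharP l p] (hb : b ^ p - b = algebraMap k l a) :
    ((X ^ p - X - C a).map (algebraMap k l)).Splits := by
  convert! ((GaloisField.splits_zmod_X_pow_sub_X p).map (ZMod.castHom dvd_rfl l)).comp_X_sub_C b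
    using 1
  simp only [Polynomial.map_sub, Polynomial.map_pow, map_X, map_C, ← hb, sub_comp, pow_comp, X_comp,
    sub_pow_char, C_sub, C_pow]
  ring

theorem isGalois [Fact p.Prime] [CharP k p] (hb : b ^ p - b = algebraMap k l a)
    (hgen : Algebra.adjoin k {b} = ⊤) : IsGalois k l := by
  have : CharP l p := charP_of_injective_algebraMap (algebraMap k l).injective p
  have hp : 1 < p := (Fact.out : p.Prime).one_lt
  have hf := monic (a := a) hp
  have : (X ^ p - X - C a : k[X]).IsSplittingField k l :=
    { splits' := splits hb
      adjoin_rootSet' := by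
        rw [← top_le_iff, ← hgen]
        refine Algebra.adjoin_mono ?_
        rw [Set.singleton_subset_iff, mem_rootSet]
        exact ⟨hf.ne_zero, by simp [hb]⟩ }
  refine IsGalois.of_separable_splitting_field (p := X ^ p - X - C a) ?_
  rw [separable_def]
  simpa [derivative_X_pow] using isCoprime_one_right.neg_right

section Valuation

variable {w : AddValuation l (WithTop ℤ)} {d i : ℤ}

theorem exists_map_term_eq (hw : ∀ c : k, c ≠ 0 → ∃ n : ℤ, w (algebraMap k l c) = (d * (p * n) : ℤ))
    (hwb : w b = (-(d * i) : ℤ)) {c : k} (hc : c ≠ 0) (m : ℕ) :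
    ∃ n : ℤ, w (algebraMap k l c * b ^ m) = (d * (p * n - m * i) : ℤ) := by
  obtain ⟨n, hn⟩ := hw c hc
  refine ⟨n, ?_⟩
  rw [w.map_mul, w.map_pow, hn, hwb, ← WithTop.coe_nsmul, ← WithTop.coe_add, WithTop.coe_inj,
    nsmul_eq_mul]
  ring

/-- The terms of `∑ c_m b ^ m` with `m < p` have distinct valuations, as these are distinct
modulo `p`. -/
theorem exists_map_sum_eq [Fact p.Prime] (hd : d ≠ 0) (hip : ¬ (p : ℤ) ∣ i)
    (hw : ∀ c : k, c ≠ 0 → ∃ n : ℤ, w (algebraMap k l c) = (d * (p * n) : ℤ))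
    (hwb : w b = (-(d * i) : ℤ)) (c : Fin p → k) :
    ∃ m, w (∑ n, algebraMap k l (c n) * b ^ (n : ℕ)) = w (algebraMap k l (c m) * b ^ (m : ℕ)) ∧
      ∀ n, w (algebraMap k l (c m) * b ^ (m : ℕ)) ≤ w (algebraMap k l (c n) * b ^ (n : ℕ)) := by
  have : NeZero p := ⟨(Fact.out : p.Prime).ne_zero⟩
  suffices h : ∀ m ∈ Finset.univ, ∀ n ∈ Finset.univ,
      w (algebraMap k l (c m) * b ^ (m : ℕ)) = w (algebraMap k l (c n) * b ^ (n : ℕ)) →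
      w (algebraMap k l (c m) * b ^ (m : ℕ)) ≠ ⊤ → m = n by
    obtain ⟨m, -, h, hmin⟩ := w.exists_map_sum_eq Finset.univ_nonempty _ h
    exact ⟨m, h, fun n ↦ hmin n (Finset.mem_univ n)⟩
  intro m _ n _ hmn htop
  have hcm : c m ≠ 0 := fun h ↦ htop (by simp [h])
  have hcn : c n ≠ 0 := fun h ↦ htop (by simp [hmn, h])
  obtain ⟨r, hr⟩ := exists_map_term_eq hw hwb hcm m
  obtain ⟨s, hs⟩ := exists_map_term_eq hw hwb hcn n
  rw [hr, hs, WithTop.coe_inj] at hmn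
  have hmn' := mul_left_cancel₀ hd hmn
  have hdvd : (p : ℤ) ∣ ((m : ℕ) - (n : ℕ) : ℤ) * i := ⟨r - s, by linear_combination -hmn'⟩
  have hdvd' := ((Nat.prime_iff_prime_int.1 Fact.out).dvd_or_dvd hdvd).resolve_right hip
  have h0 := Int.eq_zero_of_abs_lt_dvd hdvd' (by have := m.2; have := n.2; rw [abs_lt]; omega)
  exact Fin.ext (by omega)

theorem finrank_eq [Fact p.Prime] (hd : d ≠ 0) (hip : ¬ (p : ℤ) ∣ i)
    (hb : b ^ p - b = algebraMap k l a) (hgen : Algebra.adjoin k {b} = ⊤)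
    (hw : ∀ c : k, c ≠ 0 → ∃ n : ℤ, w (algebraMap k l c) = (d * (p * n) : ℤ))
    (hwb : w b = (-(d * i) : ℤ)) : Module.finrank k l = p := by
  have hli : LinearIndependent k fun m : Fin p ↦ b ^ (m : ℕ) := by
    rw [Fintype.linearIndependent_iff]
    intro c hc n
    simp only [Algebra.smul_def] at hc
    obtain ⟨m, hm, hmin⟩ := exists_map_sum_eq hd hip hw hwb c
    rw [hc, w.map_zero] at hm
    by_contra hcn
    obtain ⟨r, hr⟩ := exists_map_term_eq hw hwb hcn n
    have := hmin n
    rw [← hm, hr, top_le_iff] at this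
    exact WithTop.coe_ne_top this
  have hspan : ⊤ ≤ Submodule.span k (Set.range fun m : Fin p ↦ b ^ (m : ℕ)) := by
    intro x _
    obtain ⟨c, rfl⟩ := exists_eq_sum (Fact.out : p.Prime).one_lt hb hgen x
    refine Submodule.sum_mem _ fun m _ ↦ ?_
    rw [← Algebra.smul_def]
    exact Submodule.smul_mem _ _ (Submodule.subset_span ⟨m, rfl⟩)
  simpa using Module.finrank_eq_card_basis (Module.Basis.mk hli hspan)

/-- The valuation of an element of `k(b)` is a multiple of `d`. -/
theorem dvd_of_map_eq [Fact p.Prime] (hd : d ≠ 0) (hip : ¬ (p : ℤ) ∣ i)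
    (hb : b ^ p - b = algebraMap k l a) (hgen : Algebra.adjoin k {b} = ⊤)
    (hw : ∀ c : k, c ≠ 0 → ∃ n : ℤ, w (algebraMap k l c) = (d * (p * n) : ℤ))
    (hwb : w b = (-(d * i) : ℤ)) {x : l} {n : ℤ} (hx : w x = n) : d ∣ n := by
  obtain ⟨c, rfl⟩ := exists_eq_sum (Fact.out : p.Prime).one_lt hb hgen x
  obtain ⟨m, hm, -⟩ := exists_map_sum_eq hd hip hw hwb c
  rw [hx] at hm
  have hcm : c m ≠ 0 := fun h ↦ by simp [h] at hm
  obtain ⟨r, hr⟩ := exists_map_term_eq hw hwb hcm m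
  rw [hr, WithTop.coe_inj] at hm
  exact ⟨_, hm⟩

theorem sub_pow_eq_self [Fact p.Prime] [CharP l p] (hb : b ^ p - b = algebraMap k l a)
    (g : l ≃ₐ[k] l) : (g b - b) ^ p = g b - b := by
  have h := congrArg g hb
  rw [map_sub, map_pow, AlgEquiv.commutes, ← hb] at h
  rw [sub_pow_char]
  linear_combination h

theorem eq_one_of_apply_eq (hgen : Algebra.adjoin k {b} = ⊤) {g : l ≃ₐ[k] l} (hg : g b = b) :
    g = 1 := by
  have h : (g : l →ₐ[k] l) = AlgHom.id k l := AlgHom.ext_of_adjoin_eq_top hgen (by simpa using hg)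
  ext x
  exact DFunLike.congr_fun h x

/-- Every automorphism over `k` lies in the `i`-th lower ramification group. -/
theorem le_map_sub_of_nonneg [Fact p.Prime] [CharP l p] (hip : ¬ (p : ℤ) ∣ i)
    (hb : b ^ p - b = algebraMap k l a) (hgen : Algebra.adjoin k {b} = ⊤)
    (hw : ∀ c : k, c ≠ 0 → ∃ n : ℤ, w (algebraMap k l c) = (p * n : ℤ))
    (hwb : w b = (-i : ℤ)) (g : l ≃ₐ[k] l) (hg : ∀ x, w (g x) = w x) {x : l} (hx : 0 ≤ w x) :
    ((i + 1 : ℤ) : WithTop ℤ) ≤ w (g x - x) := by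
  have hw' : ∀ c : k, c ≠ 0 → ∃ n : ℤ, w (algebraMap k l c) = (1 * (p * n) : ℤ) := by
    simpa using hw
  have hwb' : w b = (-(1 * i) : ℤ) := by simpa using hwb
  obtain ⟨c, rfl⟩ := exists_eq_sum (Fact.out : p.Prime).one_lt hb hgen x
  obtain ⟨m, hm, hmin⟩ := exists_map_sum_eq one_ne_zero hip hw' hwb' c
  rw [map_sum, ← Finset.sum_sub_distrib]
  refine w.map_le_sum fun n _ ↦ ?_
  rcases eq_or_ne (c n) 0 with hcn | hcn
  · simp [hcn]
  rcases eq_or_ne (n : ℕ) 0 with hn | hn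
  · simp [hn]
  let S := w.displacementSubmonoid (g : l →+* l) hg (i : WithTop ℤ)
  have hmem (y : l) : y ∈ S ↔ w y + (i : WithTop ℤ) ≤ w (g y - y) := Iff.rfl
  have hbS : b ∈ S := by
    rw [hmem, hwb, ← WithTop.coe_add, neg_add_cancel, WithTop.coe_zero]
    rcases eq_or_ne (g b - b) 0 with h | h
    · simp [h]
    · exact (AddValuation.map_eq_zero_of_pow_eq_self h (Fact.out : p.Prime).ne_one
        (sub_pow_eq_self hb g)).ge
  have hcS : algebraMap k l (c n) ∈ S := by simp [hmem]
  have hS := (hmem _).1 (S.mul_mem hcS (S.pow_mem hbS n))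
  refine le_trans ?_ hS
  obtain ⟨r, hr⟩ := exists_map_term_eq hw' hwb' hcn n
  have hnonneg := (hm ▸ hx).trans (hmin n)
  rw [hr, ← WithTop.coe_zero, WithTop.coe_le_coe, one_mul] at hnonneg
  rw [hr, ← WithTop.coe_add, WithTop.coe_le_coe, one_mul]
  have hne : (p : ℤ) * r - (n : ℕ) * i ≠ 0 := fun h ↦ by
    have hdvd : (p : ℤ) ∣ (n : ℕ) * i := ⟨r, by linear_combination -h⟩
    have := ((Nat.prime_iff_prime_int.1 Fact.out).dvd_or_dvd hdvd).resolve_right hip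
    exact Nat.not_dvd_of_pos_of_lt (Nat.pos_of_ne_zero hn) n.2 (Int.natCast_dvd_natCast.1 this)
  omega

/-- An automorphism in the `j`-th lower ramification group with `j > i` is trivial. -/
theorem eq_one_of_le_map_sub [Fact p.Prime] [CharP l p] (hi : 0 < i)
    (hb : b ^ p - b = algebraMap k l a) (hgen : Algebra.adjoin k {b} = ⊤)
    (hsurj : ∃ x, w x = (1 : ℤ)) (hwb : w b = (-i : ℤ)) (g : l ≃ₐ[k] l) (hg : ∀ x, w (g x) = w x)
    {j : ℤ} (hij : i < j) (hj : ∀ x, 0 ≤ w x → ((j + 1 : ℤ) : WithTop ℤ) ≤ w (g x - x)) :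
    g = 1 := by
  refine eq_one_of_apply_eq hgen (sub_eq_zero.1 ?_)
  by_contra hne
  obtain ⟨π, hπ⟩ := hsurj
  have hπ0 : π ≠ 0 := w.ne_top_iff.1 (hπ ▸ WithTop.coe_ne_top)
  lift i to ℕ using hi.le
  let S := w.displacementSubmonoid (g : l →+* l) hg (j : WithTop ℤ)
  have hmem (y : l) : y ∈ S ↔ w y + (j : WithTop ℤ) ≤ w (g y - y) := Iff.rfl
  have hπS : π ∈ S := by
    rw [hmem, hπ, ← WithTop.coe_add, add_comm]
    exact hj π (by rw [hπ]; exact_mod_cast zero_le_one)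
  have hu : w (b * π ^ i) = 0 := by
    rw [w.map_mul, w.map_pow, hwb, hπ, ← WithTop.coe_nsmul, ← WithTop.coe_add]
    simp
  have huS : b * π ^ i ∈ S := by
    rw [hmem, hu, zero_add]
    exact le_trans (WithTop.coe_le_coe.2 (by omega)) (hj _ hu.ge)
  have hbS : b ∈ S := by
    have := S.mul_mem huS (w.inv_mem_displacementSubmonoid (S.pow_mem hπS i))
    rwa [mul_inv_cancel_right₀ (pow_ne_zero i hπ0)] at this
  rw [hmem, hwb, ← WithTop.coe_add] at hbS
  rw [AddValuation.map_eq_zero_of_pow_eq_self hne (Fact.out : p.Prime).ne_one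
    (sub_pow_eq_self hb g), ← WithTop.coe_zero, WithTop.coe_le_coe] at hbS
  omega

end Valuation

end ArtinSchreier

open HahnSeries

/-- Let `k = F((u))` be a local field of characteristic `p` and `a ∈ k` with `v_k(a) = -i`,
`i > 0` prime to `p`.  Then the Artin–Schreier extension `l = k(b)`, `b^p - b = a`, is a
totally ramified cyclic extension of degree `p` whose ramification filtration in lower
numbering satisfies `Gal(l/k)_j = Gal(l/k)` for `j ≤ i` and `Gal(l/k)_j = 1` for `j > i`. -/
theorem artinSchreier_ramification_break
    (p : ℕ) [Fact p.Prime] {F : Type*} [Field F] [Finite F] [CharP F p]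
    (i : ℤ) (hi : 0 < i) (hip : ¬ (p : ℤ) ∣ i)
    (a : LaurentSeries F) (hva : addVal ℤ F a = ((-i : ℤ) : WithTop ℤ))
    {l : Type*} [Field l] [Algebra (LaurentSeries F) l]
    (b : l) (hb : b ^ p - b = algebraMap (LaurentSeries F) l a)
    (hgen : Algebra.adjoin (LaurentSeries F) {b} = ⊤)
    -- `w` is the extension of the valuation of `k` to `l`, normalized with value group `ℤ`,
    -- with ramification index `e`
    (w : AddValuation l (WithTop ℤ))
    (hsurj : ∀ n : ℤ, ∃ x : l, x ≠ 0 ∧ w x = (n : WithTop ℤ))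
    (hzero : ∀ x : l, w x = ⊤ ↔ x = 0)
    (e : ℤ) (he : 0 < e)
    (hext : ∀ x : LaurentSeries F, x ≠ 0 → ∀ n : ℤ, addVal ℤ F x = (n : WithTop ℤ) →
      w (algebraMap (LaurentSeries F) l x) = ((e * n : ℤ) : WithTop ℤ))
    (hpres : ∀ (g : l ≃ₐ[LaurentSeries F] l) (x : l), w (g x) = w x) :
    -- `l/k` is totally ramified, cyclic of degree `p`
    e = p ∧ Module.finrank (LaurentSeries F) l = p ∧
    IsGalois (LaurentSeries F) l ∧ IsCyclic (l ≃ₐ[LaurentSeries F] l) ∧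
    -- the ramification filtration has a single break at `i`
    ∀ j : ℤ, 0 ≤ j →
      ((j ≤ i → {g : l ≃ₐ[LaurentSeries F] l |
          ∀ x : l, (0 : WithTop ℤ) ≤ w x → (((j + 1 : ℤ)) : WithTop ℤ) ≤ w (g x - x)} =
          Set.univ) ∧
       (i < j → {g : l ≃ₐ[LaurentSeries F] l |
          ∀ x : l, (0 : WithTop ℤ) ≤ w x → (((j + 1 : ℤ)) : WithTop ℤ) ≤ w (g x - x)} =
          {1})) := by
  have hp : p.Prime := Fact.out
  have : CharP (LaurentSeries F) p := charP_of_injective_ringHom (C_injective (Γ := ℤ) (R := F)) p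
  have : CharP l p :=
    charP_of_injective_algebraMap (algebraMap (LaurentSeries F) l).injective p
  have ha : a ≠ 0 := (addVal ℤ F).ne_top_iff.1 (hva ▸ WithTop.coe_ne_top)
  obtain ⟨n, hwb, hn⟩ := AddValuation.exists_map_eq_of_pow_sub_self hp.one_lt
    (c := e * -i) (by nlinarith) (hb ▸ hext a ha (-i) hva)
  obtain ⟨d, rfl⟩ : (p : ℤ) ∣ e :=
    ((Nat.prime_iff_prime_int.1 hp).dvd_or_dvd (⟨-n, by linear_combination hn⟩ :
      (p : ℤ) ∣ e * i)).resolve_right hip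
  have hp0 : (p : ℤ) ≠ 0 := by exact_mod_cast hp.ne_zero
  obtain rfl : n = -(d * i) := mul_left_cancel₀ hp0 (by linear_combination hn)
  have hd : 0 < d := pos_of_mul_pos_right he (by positivity)
  have hw : ∀ c : LaurentSeries F, c ≠ 0 →
      ∃ n : ℤ, w (algebraMap (LaurentSeries F) l c) = (d * (p * n) : ℤ) := fun c hc ↦
    ⟨c.order, by rw [hext c hc _ (addVal_apply_of_ne hc)]; congr 1; ring⟩
  obtain ⟨π, -, hπ⟩ := hsurj 1
  obtain rfl : d = 1 := Int.eq_one_of_dvd_one hd.le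
    (ArtinSchreier.dvd_of_map_eq hd.ne' hip hb hgen hw hwb hπ)
  have hrank := ArtinSchreier.finrank_eq hd.ne' hip hb hgen hw hwb
  have hgal := ArtinSchreier.isGalois (p := p) hb hgen
  have : FiniteDimensional (LaurentSeries F) l :=
    Module.finite_of_finrank_pos (hrank ▸ hp.pos)
  simp only [one_mul] at hw hwb
  refine ⟨mul_one _, hrank, hgal, isCyclic_of_prime_card (p := p) ?_, fun j _ ↦ ⟨fun hj ↦ ?_,
    fun hj ↦ ?_⟩⟩
  · rw [IsGalois.card_aut_eq_finrank, hrank]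
  · exact Set.eq_univ_of_forall fun g x hx ↦ le_trans (WithTop.coe_le_coe.2 (by omega))
      (ArtinSchreier.le_map_sub_of_nonneg hip hb hgen hw hwb g (hpres g) hx)
  · refine Set.eq_singleton_iff_unique_mem.2 ⟨fun x _ ↦ by simp, fun g hg ↦ ?_⟩
    exact ArtinSchreier.eq_one_of_le_map_sub hi hb hgen ⟨π, hπ⟩ hwb g (hpres g) hj hg
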